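/- arXiv:2308.13277 — 2 statements merged into one kernel-verified Lean document; each statement's English description precedes it below -/
import Mathlib

section
/- There exist constants c > 0 and k > 0 such that for every n ≥ 2, the smallest nonzero eigenvalue of H_{W,0} = Σ_{i=1}^{n−1} P_{i,i+1} on (ℂ²)^{⊗n} is at least c·n^{−k}; i.e., the spectral gap above the (two-dimensional) ground space of H_{W,0} closes at most polynomially fast in n. -/
open Matrix
open scoped Kronecker ComplexOrder

namespace QSim

/-- Index set for the computational basis of `n` qubits. -/
abbrev QIdx (n : ℕ) := Fin n → Fin 2

/-- Operators (matrices) on the Hilbert space of `n` qubits. -/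
abbrev QOp (n : ℕ) := Matrix (QIdx n) (QIdx n) ℂ

/-- The operator (`ℓ²→ℓ²`) norm of a (possibly rectangular) matrix. -/
noncomputable def opNorm {I J : Type*} [Fintype I] [Fintype J] [DecidableEq J]
    (M : Matrix I J ℂ) : ℝ :=
  ‖LinearMap.toContinuousLinearMap (Matrix.toEuclideanLin M)‖

/-- A two-qubit operator `E` placed on qubits `i` and `j` of an `n`-qubit register
(identity elsewhere), given entrywise. -/
def twoQubitOp (n : ℕ) (i j : Fin n) (E : Fin 2 → Fin 2 → Fin 2 → Fin 2 → ℂ) : QOp n :=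
  fun x y => E (x i) (x j) (y i) (y j) * (if ∀ k, k ≠ i → k ≠ j → x k = y k then 1 else 0)

/-- A single-qubit operator `E` placed on qubit `i` of an `n`-qubit register. -/
def oneQubitOp (n : ℕ) (i : Fin n) (E : Matrix (Fin 2) (Fin 2) ℂ) : QOp n :=
  fun x y => E (x i) (y i) * (if ∀ k, k ≠ i → x k = y k then 1 else 0)

/-- Sign used to build `(|01⟩ - |10⟩)/√2`. -/
def sgnE (a b : Fin 2) : ℂ :=
  if a = 0 ∧ b = 1 then 1 else if a = 1 ∧ b = 0 then -1 else 0

/-- Entries of the two-qubit projector `P` onto `span{(|01⟩-|10⟩)/√2, |11⟩}`: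
`P = (1/2)(|01⟩-|10⟩)(⟨01|-⟨10|) + |11⟩⟨11|`. -/
noncomputable def Pentry (a b c d : Fin 2) : ℂ :=
  (1 / 2) * sgnE a b * sgnE c d + (if a = 1 ∧ b = 1 ∧ c = 1 ∧ d = 1 then 1 else 0)

/-- `H_{W,0} = Σ_{i=1}^{n-1} P_{i,i+1}`. -/
noncomputable def HW0 (n : ℕ) : QOp n :=
  ∑ i : Fin (n - 1),
    twoQubitOp n ⟨i.1, by have := i.2; omega⟩ ⟨i.1 + 1, by have := i.2; omega⟩ Pentry

/-- The all-zeros state `|0…0⟩`. -/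
def ket0 (n : ℕ) : QIdx n → ℂ := fun x => if ∀ k, x k = 0 then 1 else 0

/-- The generalized W state `|W_n⟩ = n^{-1/2} Σ_i |e_i⟩`. -/
noncomputable def Wstate (n : ℕ) : QIdx n → ℂ := fun x =>
  if (Finset.univ.filter fun k => x k = 1).card = 1 then (((Real.sqrt n)⁻¹ : ℝ) : ℂ) else 0

end QSim

namespace QSim

/-- Action of the two-qubit projector `P` on two qubits: half a difference under the
exchange of the two qubits, plus a penalty when both qubits are excited. -/
theorem twoQubitOp_Pentry_mulVec {n : ℕ} (a b : Fin n) (ψ : QIdx n → ℂ) (x : QIdx n) :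
    (twoQubitOp n a b Pentry *ᵥ ψ) x =
      (ψ x - ψ (x ∘ Equiv.swap a b)) / 2 + if x a = 1 ∧ x b = 1 then ψ x else 0 := by
  have entry : ∀ y, twoQubitOp n a b Pentry x y =
      ((if y = x then 1 else 0) - (if y = x ∘ Equiv.swap a b then 1 else 0)) / 2 +
        if x a = 1 ∧ x b = 1 then (if y = x then 1 else 0) else 0 := by
    intro y
    by_cases h : ∀ k, k ≠ a → k ≠ b → x k = y k
    · have h1 : y = x ↔ y a = x a ∧ y b = x b := by
        refine ⟨fun e => by simp [e], fun e => ?_⟩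
        funext k
        by_cases ka : k = a
        · rw [ka, e.1]
        by_cases kb : k = b
        · rw [kb, e.2]
        exact (h k ka kb).symm
      have h2 : y = x ∘ Equiv.swap a b ↔ y a = x b ∧ y b = x a := by
        refine ⟨fun e => by simp [e], fun e => ?_⟩
        funext k
        by_cases ka : k = a
        · simp [ka, e.1]
        by_cases kb : k = b
        · simp [kb, e.2]
        simp [Equiv.swap_apply_of_ne_of_ne ka kb, (h k ka kb).symm]
      simp only [twoQubitOp, if_pos h, h1, h2]
      generalize x a = p, x b = q, y a = r, y b = s
      fin_cases p <;> fin_cases q <;> fin_cases r <;> fin_cases s <;>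
        norm_num [Pentry, sgnE]
    · have h1 : y ≠ x := fun e => h fun k _ _ => by rw [e]
      have h2 : y ≠ x ∘ Equiv.swap a b := fun e => h fun k ka kb => by
        simp [e, Equiv.swap_apply_of_ne_of_ne ka kb]
      simp [twoQubitOp, h, h1, h2]
  simp only [mulVec, dotProduct, entry, add_mul, Finset.sum_add_distrib, sub_mul, div_mul_eq_mul_div,
    ← Finset.sum_div, Finset.sum_sub_distrib, ite_mul, one_mul, zero_mul, Finset.sum_ite_eq',
    Finset.mem_univ, if_true]
  split_ifs <;> simp

/-- Exchange of the neighbouring qubits `i` and `i + 1`. -/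
def hop {m : ℕ} (i : Fin m) (x : QIdx (m + 1)) : QIdx (m + 1) :=
  x ∘ Equiv.swap i.castSucc i.succ

theorem HW0_mulVec {m : ℕ} (ψ : QIdx (m + 1) → ℂ) (x : QIdx (m + 1)) :
    (HW0 (m + 1) *ᵥ ψ) x = ∑ i : Fin m, ((ψ x - ψ (hop i x)) / 2 +
      if x i.castSucc = 1 ∧ x i.succ = 1 then ψ x else 0) := by
  have h : HW0 (m + 1) = ∑ i : Fin m, twoQubitOp (m + 1) i.castSucc i.succ Pentry := rfl
  rw [h, Matrix.sum_mulVec, Finset.sum_apply]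
  exact Finset.sum_congr rfl fun i _ =>
    twoQubitOp_Pentry_mulVec _ _ ψ x

/-- Barta-type bound for the generator of a jump process with killing: an eigenvalue whose
eigenvector does not vanish on a closed set `S` is bounded below there by the ratio of the generator
applied to a positive test function `f` and `f` itself. -/
theorem exists_generator_le_eigenvalue_mul {X ι : Type*} [Finite X] [Fintype ι]
    (σ : ι → X → X) (K : ι → X → Prop) [∀ i x, Decidable (K i x)] (ψ : X → ℂ) (μ : ℝ)
    (hψ : ∀ x, ∑ i, ((ψ x - ψ (σ i x)) / 2 + if K i x then ψ x else 0) = μ * ψ x)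
    (S : Set X) (hS : ∀ i, ∀ x ∈ S, σ i x ∈ S) (f : X → ℝ) (hf : ∀ x ∈ S, 0 < f x)
    {x₀ : X} (hx₀ : x₀ ∈ S) (hne : ψ x₀ ≠ 0) :
    ∃ x ∈ S, ∑ i, ((f x - f (σ i x)) / 2 + if K i x then f x else 0) ≤ μ * f x := by
  obtain ⟨x, hxS, hx⟩ :=
    Set.exists_max_image S (fun x => ‖ψ x‖ / f x) S.toFinite ⟨x₀, hx₀⟩
  refine ⟨x, hxS, ?_⟩
  set R := ‖ψ x‖ / f x with hR
  have hfx := hf x hxS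
  have hR_pos : 0 < R := (div_pos (norm_pos_iff.2 hne) (hf x₀ hx₀)).trans_le (hx x₀ hx₀)
  have hψx : ‖ψ x‖ = R * f x := by rw [hR, div_mul_cancel₀ _ hfx.ne']
  have hbound : ∀ i, ‖ψ (σ i x)‖ ≤ R * f (σ i x) := fun i =>
    (div_le_iff₀ (hf _ (hS i x hxS))).1 (hx _ (hS i x hxS))
  set D : ℝ := ∑ i : ι, (1 / 2 + if K i x then 1 else 0) with hD
  have hsplitψ : (((D - μ : ℝ)) : ℂ) * ψ x = ∑ i, ψ (σ i x) / 2 := by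
    have h := hψ x
    have e : ∑ i, ((ψ x - ψ (σ i x)) / 2 + if K i x then ψ x else 0) =
        (D : ℂ) * ψ x - ∑ i, ψ (σ i x) / 2 := by
      rw [hD]
      push_cast
      rw [Finset.sum_mul, ← Finset.sum_sub_distrib]
      refine Finset.sum_congr rfl fun i _ => ?_
      split_ifs <;> simp <;> ring
    rw [e] at h
    push_cast
    linear_combination h
  have hsplitf : ∑ i, ((f x - f (σ i x)) / 2 + if K i x then f x else 0) =
      D * f x - ∑ i, f (σ i x) / 2 := by
    rw [hD, Finset.sum_mul, ← Finset.sum_sub_distrib]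
    refine Finset.sum_congr rfl fun i _ => ?_
    split_ifs <;> ring
  have hnorm : (D - μ) * ‖ψ x‖ ≤ R * ∑ i, f (σ i x) / 2 := by
    calc (D - μ) * ‖ψ x‖ ≤ ‖(((D - μ : ℝ)) : ℂ) * ψ x‖ := by
          rw [norm_mul, Complex.norm_real]
          exact mul_le_mul_of_nonneg_right (le_abs_self _) (norm_nonneg _)
      _ ≤ ∑ i, ‖ψ (σ i x) / 2‖ := by rw [hsplitψ]; exact norm_sum_le _ _
      _ ≤ ∑ i, R * (f (σ i x) / 2) := by
          refine Finset.sum_le_sum fun i _ => ?_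
          rw [norm_div, Complex.norm_ofNat]
          linarith [hbound i]
      _ = _ := by rw [Finset.mul_sum]
  rw [hψx] at hnorm
  have : (D - μ) * f x ≤ ∑ i, f (σ i x) / 2 :=
    le_of_mul_le_mul_left (by linarith) hR_pos
  rw [hsplitf]
  linarith

/-- Position of the first excited qubit. -/
noncomputable def firstOne {n : ℕ} (x : QIdx n) : ℕ :=
  sInf {k | ∃ i : Fin n, x i = 1 ∧ i.val = k}

theorem firstOne_eq {n : ℕ} {x : QIdx n} {p : Fin n} (hp : x p = 1) (hlt : ∀ q < p, x q ≠ 1) :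
    firstOne x = p := by
  refine IsLeast.csInf_eq ⟨⟨p, hp, rfl⟩, ?_⟩
  rintro k ⟨i, hi, rfl⟩
  by_contra! h
  exact hlt i h hi

/-- The configurations with at least two excited qubits. -/
def multiExcited (n : ℕ) : Set (QIdx n) := {x | ∃ p q, p < q ∧ x p = 1 ∧ x q = 1}

theorem hop_mem_multiExcited {m : ℕ} (i : Fin m) {x : QIdx (m + 1)}
    (hx : x ∈ multiExcited (m + 1)) : hop i x ∈ multiExcited (m + 1) := by
  obtain ⟨p, q, hpq, hp, hq⟩ := hx
  set s := Equiv.swap i.castSucc i.succ with hs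
  have hp' : hop i x (s p) = 1 := by simp [hop, hs, hp]
  have hq' : hop i x (s q) = 1 := by simp [hop, hs, hq]
  rcases lt_or_gt_of_ne (s.injective.ne hpq.ne) with h | h
  · exact ⟨_, _, h, hp', hq'⟩
  · exact ⟨_, _, h, hq', hp'⟩

/-- Test function for the sectors with at least two excitations. -/
noncomputable def testFun {m : ℕ} (x : QIdx (m + 1)) : ℝ := ((m : ℝ) + 1) ^ 2 - (firstOne x : ℝ) ^ 2

theorem exists_first {m : ℕ} {x : QIdx (m + 1)} (hx : x ∈ multiExcited (m + 1)) :
    ∃ r : Fin m, x r.castSucc = 1 ∧ ∀ q < r.castSucc, x q ≠ 1 := by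
  classical
  obtain ⟨p, q, hpq, hp, hq⟩ := hx
  obtain ⟨t, ht, hmin⟩ := (Set.toFinite {i | x i = 1}).exists_minimal ⟨p, hp⟩
  have hlt : ∀ j < t, x j ≠ 1 := fun j hj h => absurd (hmin h hj.le) (not_le.2 hj)
  have htp : t ≤ p := le_of_not_gt fun h => hlt p h hp
  have htm : t.val < m := by
    have := q.2
    have h1 : t.val ≤ p.val := htp
    have h2 : p.val < q.val := hpq
    omega
  exact ⟨⟨t, htm⟩, ht, hlt⟩

theorem testFun_pos {m : ℕ} {x : QIdx (m + 1)} (hx : x ∈ multiExcited (m + 1)) :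
    0 < testFun x := by
  obtain ⟨r, hr, hlt⟩ := exists_first hx
  have h : ((r : ℕ) : ℝ) < m := by exact_mod_cast r.2
  have h0 : (0 : ℝ) ≤ (r : ℕ) := by positivity
  rw [testFun, firstOne_eq hr hlt, Fin.val_castSucc]
  nlinarith

theorem half_le_generator_testFun {m : ℕ} {x : QIdx (m + 1)} (hx : x ∈ multiExcited (m + 1)) :
    1 / 2 ≤ ∑ i : Fin m, ((testFun x - testFun (hop i x)) / 2 +
      if x i.castSucc = 1 ∧ x i.succ = 1 then testFun x else 0) := by
  have hpos := testFun_pos hx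
  obtain ⟨r, hr, hlt⟩ := exists_first hx
  have hrm : ((r : ℕ) : ℝ) + 1 ≤ m := by exact_mod_cast r.2
  have hr0 : (0 : ℝ) ≤ (r : ℕ) := by positivity
  have hfx : testFun x = ((m : ℝ) + 1) ^ 2 - ((r : ℕ) : ℝ) ^ 2 := by
    rw [testFun, firstOne_eq hr hlt, Fin.val_castSucc]
  have hterm : ∀ i : Fin m,
      (if i = r then ((r : ℕ) : ℝ) + 1 / 2 else 0) +
        (if i.val + 1 = r.val then -((r : ℕ) : ℝ) else 0) ≤
      (testFun x - testFun (hop i x)) / 2 +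
        if x i.castSucc = 1 ∧ x i.succ = 1 then testFun x else 0 := by
    intro i
    by_cases hi : i = r
    · subst hi
      rw [if_pos rfl, if_neg (by omega)]
      by_cases hK : x i.succ = 1
      · have hhop : hop i x = x := by
          funext j
          by_cases h1 : j = i.castSucc
          · simp [hop, h1, hK, hr]
          by_cases h2 : j = i.succ
          · simp [hop, h2, hK, hr]
          simp [hop, Equiv.swap_apply_of_ne_of_ne h1 h2]
        rw [hhop, if_pos ⟨hr, hK⟩, hfx]
        nlinarith
      · have hfirst : firstOne (hop i x) = i.succ := by
          refine firstOne_eq (by simp [hop, hr]) fun q hq => ?_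
          by_cases h1 : q = i.castSucc
          · simpa [hop, h1] using hK
          have h3 : q < i.castSucc := lt_of_le_of_ne (Fin.le_castSucc_iff.2 hq) h1
          simpa [hop, Equiv.swap_apply_of_ne_of_ne h1 hq.ne] using hlt q h3
        rw [if_neg (by tauto), hfx, testFun, hfirst, Fin.val_succ]
        push_cast
        nlinarith
    rw [if_neg hi]
    have hkill : 0 ≤ if x i.castSucc = 1 ∧ x i.succ = 1 then testFun x else 0 := by
      split_ifs <;> linarith
    by_cases hi' : i.val + 1 = r.val
    · rw [if_pos hi']
      have hir : i.succ = r.castSucc := Fin.ext (by simpa using hi')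
      have hfirst : firstOne (hop i x) = i.castSucc := by
        refine firstOne_eq (by simp [hop, hir, hr]) fun q hq => ?_
        have h2 : q < i.succ := hq.trans Fin.castSucc_lt_succ
        simpa [hop, Equiv.swap_apply_of_ne_of_ne hq.ne h2.ne] using hlt q (hir ▸ h2)
      have hcast : ((r : ℕ) : ℝ) = (i : ℕ) + 1 := by exact_mod_cast hi'.symm
      have hstep : -((r : ℕ) : ℝ) ≤ (testFun x - testFun (hop i x)) / 2 := by
        rw [hfx, testFun, hfirst, Fin.val_castSucc, hcast]
        nlinarith
      linarith
    · rw [if_neg hi']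
      have hfirst : firstOne (hop i x) = r.castSucc := by
        have hne : i.val ≠ r.val := fun h => hi (Fin.ext h)
        have h1 : r.castSucc ≠ i.castSucc := fun h => hne (by simpa using (congrArg Fin.val h).symm)
        have h2 : r.castSucc ≠ i.succ := fun h => hi' (by simpa using (congrArg Fin.val h).symm)
        refine firstOne_eq (by simp [hop, Equiv.swap_apply_of_ne_of_ne h1 h2, hr]) fun q hq => ?_
        refine hlt _ ?_
        rw [Equiv.swap_apply_def]
        simp only [Fin.lt_def, Fin.ext_iff, Fin.val_castSucc, Fin.val_succ] at hq ⊢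
        split_ifs <;> first | omega | (simp only [Fin.val_castSucc, Fin.val_succ]; omega)
      have hsame : testFun (hop i x) = testFun x := by
        rw [testFun, hfirst, testFun, firstOne_eq hr hlt]
      rw [hsame]
      linarith
  have hleft : -((r : ℕ) : ℝ) ≤ ∑ i : Fin m, if i.val + 1 = r.val then -((r : ℕ) : ℝ) else 0 := by
    rcases Nat.eq_zero_or_pos r.val with h | h
    · simp [h]
    · have hr' := r.2
      have e : ∀ i : Fin m, i.val + 1 = r.val ↔ i = ⟨r.val - 1, by omega⟩ := fun i => by
        rw [Fin.ext_iff]; dsimp only; omega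
      simp only [e, Finset.sum_ite_eq', Finset.mem_univ, if_true, le_refl]
  refine le_trans ?_ (Finset.sum_le_sum fun i _ => hterm i)
  rw [Finset.sum_add_distrib, Finset.sum_ite_eq' Finset.univ r, if_pos (Finset.mem_univ r)]
  linarith

theorem sum_mul_sub_swap {ι : Type*} [Fintype ι] [DecidableEq ι] (w u : ι → ℂ) {a b : ι}
    (hab : a ≠ b) : ∑ j, w j * (u j - u (Equiv.swap a b j)) = (w a - w b) * (u a - u b) := by
  rw [Fintype.sum_eq_add a b hab fun j hj => by
    rw [Equiv.swap_apply_of_ne_of_ne hj.1 hj.2, sub_self, mul_zero],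
    Equiv.swap_apply_left, Equiv.swap_apply_right]
  ring

/-- Spectral gap of (half) the Laplacian of the path with `m + 1` vertices. -/
theorem one_le_path_eigenvalue {m : ℕ} (u : Fin (m + 1) → ℂ) (hu : u ≠ 0) {μ : ℝ} (hμ : 0 < μ)
    (h : ∀ j, ∑ i : Fin m, (u j - u (Equiv.swap i.castSucc i.succ j)) / 2 = μ * u j) :
    1 ≤ 4 * μ * ((m : ℝ) + 1) ^ 2 := by
  have weighted : ∀ w : Fin (m + 1) → ℂ, μ * ∑ j, w j * u j =
      ∑ i : Fin m, (w i.castSucc - w i.succ) * (u i.castSucc - u i.succ) / 2 := by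
    intro w
    calc (μ : ℂ) * ∑ j, w j * u j
        = ∑ j, w j * ∑ i : Fin m, (u j - u (Equiv.swap i.castSucc i.succ j)) / 2 := by
          rw [Finset.mul_sum]
          exact Finset.sum_congr rfl fun j _ => by rw [h j]; ring
      _ = ∑ i : Fin m, (∑ j, w j * (u j - u (Equiv.swap i.castSucc i.succ j))) / 2 := by
          simp only [Finset.mul_sum, Finset.sum_div]
          rw [Finset.sum_comm]
          simp only [mul_div_assoc]
      _ = _ := Finset.sum_congr rfl fun i _ => by
          rw [sum_mul_sub_swap w u (Fin.castSucc_lt_succ).ne]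
  have hμC : (μ : ℂ) ≠ 0 := by exact_mod_cast hμ.ne'
  have hsum : ∑ j, u j = 0 := by
    have := weighted fun _ => 1
    simpa [hμC] using this
  obtain ⟨j₀, hj₀⟩ := Finite.exists_max fun j => ‖u j‖
  set M := ‖u j₀‖
  have hM : 0 < M := by
    obtain ⟨j, hj⟩ := Function.ne_iff.1 hu
    exact (norm_pos_iff.2 hj).trans_le (hj₀ j)
  have hstep : ∀ k : Fin m, ‖u k.castSucc - u k.succ‖ ≤ 2 * μ * ((m + 1) * M) := by
    intro k
    have e := weighted fun j => if j ≤ k.castSucc then 1 else 0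
    have hw : ∀ i : Fin m, ((if i.castSucc ≤ k.castSucc then 1 else 0) -
        (if i.succ ≤ k.castSucc then 1 else 0) : ℂ) = if i = k then 1 else 0 := by
      intro i
      simp only [Fin.le_def, Fin.ext_iff, Fin.val_castSucc, Fin.val_succ]
      split_ifs <;> first | omega | simp
    simp only [hw, ite_mul, one_mul, zero_mul, ite_div, zero_div, Finset.sum_ite_eq',
      Finset.mem_univ, if_true] at e
    have e' : u k.castSucc - u k.succ = 2 * μ * ∑ j, if j ≤ k.castSucc then u j else 0 := by
      linear_combination (-2) * e
    rw [e', norm_mul, norm_mul, Complex.norm_real, Complex.norm_ofNat, Real.norm_of_nonneg hμ.le]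
    refine mul_le_mul_of_nonneg_left ?_ (by positivity)
    refine (norm_sum_le _ _).trans ((Finset.sum_le_sum fun j _ =>
      (?_ : _ ≤ M)).trans (by simp))
    split_ifs
    · exact hj₀ j
    · simpa using hM.le
  have hdist : ∀ j : Fin (m + 1), ‖u 0 - u j‖ ≤ (j : ℕ) * (2 * μ * ((m + 1) * M)) := by
    intro j
    induction j using Fin.induction with
    | zero => simp
    | succ k ih =>
      have := (norm_sub_le_norm_sub_add_norm_sub (u 0) (u k.castSucc) (u k.succ)).trans
        (add_le_add ih (hstep k))
      simp only [Fin.val_castSucc, Fin.val_succ] at this ⊢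
      push_cast
      linarith
  set B := ((m : ℝ) + 1) * (2 * μ * ((m + 1) * M)) with hB
  have hdist' : ∀ j, ‖u 0 - u j‖ ≤ B := fun j => (hdist j).trans
    (mul_le_mul_of_nonneg_right (by exact_mod_cast j.2.le) (by positivity))
  have hzero : ‖u 0‖ ≤ B := by
    have e : ((m : ℂ) + 1) * u 0 = ∑ j, (u 0 - u j) := by
      simp [Finset.sum_sub_distrib, hsum]
    have hn : ((m : ℝ) + 1) * ‖u 0‖ ≤ (m + 1) * B := by
      calc ((m : ℝ) + 1) * ‖u 0‖ = ‖((m : ℂ) + 1) * u 0‖ := by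
            rw [norm_mul]; congr 1; exact_mod_cast (Complex.norm_natCast (m + 1)).symm
        _ ≤ ∑ j : Fin (m + 1), B := by
            rw [e]; exact (norm_sum_le _ _).trans (Finset.sum_le_sum fun j _ => hdist' j)
        _ = _ := by simp
    exact le_of_mul_le_mul_left hn (by positivity)
  have hfinal : M ≤ 2 * B := by
    have := norm_sub_norm_le (u j₀) (u 0)
    rw [norm_sub_rev] at this
    linarith [hdist' j₀]
  refine le_of_mul_le_mul_right (?_ : 1 * M ≤ _) hM
  rw [hB] at hfinal
  linarith

theorem hop_single {m : ℕ} (i : Fin m) (j : Fin (m + 1)) :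
    hop i (Pi.single j 1) = Pi.single (Equiv.swap i.castSucc i.succ j) 1 := by
  funext k
  simp only [hop, Function.comp_apply, Pi.single_apply, Equiv.swap_apply_eq_iff]

theorem eq_zero_or_single_of_notMem_multiExcited {n : ℕ} {x : QIdx n} (hx : x ∉ multiExcited n) :
    x = 0 ∨ ∃ j, x = Pi.single j 1 := by
  by_cases h : ∃ j, x j = 1
  · obtain ⟨j, hj⟩ := h
    refine Or.inr ⟨j, funext fun k => ?_⟩
    by_cases hk : k = j
    · rw [hk, hj, Pi.single_eq_same]
    · rw [Pi.single_eq_of_ne hk]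
      by_contra hne
      have hk1 : x k = 1 := by omega
      rcases lt_or_gt_of_ne hk with h | h
      · exact hx ⟨k, j, h, hk1, hj⟩
      · exact hx ⟨j, k, h, hj, hk1⟩
  · push Not at h
    exact Or.inl (funext fun k => by have := h k; simp only [Pi.zero_apply]; omega)

theorem one_le_eigenvalue_mul_sq {m : ℕ} {μ : ℝ} (hμ : μ ≠ 0) {ψ : QIdx (m + 1) → ℂ} (hψ : ψ ≠ 0)
    (heig : HW0 (m + 1) *ᵥ ψ = (μ : ℂ) • ψ) : 1 ≤ 4 * μ * ((m : ℝ) + 1) ^ 2 := by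
  have hgen : ∀ x, ∑ i : Fin m, ((ψ x - ψ (hop i x)) / 2 +
      if x i.castSucc = 1 ∧ x i.succ = 1 then ψ x else 0) = μ * ψ x := fun x => by
    rw [← HW0_mulVec, heig, Pi.smul_apply, smul_eq_mul]
  obtain ⟨x₀, hx₀⟩ := Function.ne_iff.1 hψ
  have hμ0 : 0 < μ := by
    obtain ⟨x, -, hx⟩ := exists_generator_le_eigenvalue_mul hop _ ψ μ hgen Set.univ
      (fun _ _ _ => trivial) (fun _ => 1) (fun _ _ => one_pos) (Set.mem_univ x₀) hx₀
    refine lt_of_le_of_ne ?_ hμ.symm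
    rw [mul_one] at hx
    refine le_trans (Finset.sum_nonneg fun i _ => ?_) hx
    split_ifs <;> norm_num
  by_cases hmulti : ∃ x ∈ multiExcited (m + 1), ψ x ≠ 0
  · obtain ⟨y, hyS, hy⟩ := hmulti
    obtain ⟨x, hxS, hx⟩ := exists_generator_le_eigenvalue_mul hop _ ψ μ hgen _
      (fun i _ => hop_mem_multiExcited i) testFun (fun _ => testFun_pos) hyS hy
    have h1 := (half_le_generator_testFun hxS).trans hx
    have h2 : testFun x ≤ ((m : ℝ) + 1) ^ 2 := sub_le_self _ (sq_nonneg _)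
    nlinarith [mul_le_mul_of_nonneg_left h2 hμ0.le]
  · push Not at hmulti
    have hvac : ψ 0 = 0 := by
      have h0 := hgen 0
      have hhop : ∀ i : Fin m, hop i (0 : QIdx (m + 1)) = 0 := fun i => rfl
      simpa [hhop, hμ] using h0.symm
    refine one_le_path_eigenvalue (fun j => ψ (Pi.single j 1)) (fun hu => hx₀ ?_) hμ0 fun j => ?_
    · by_cases hS : x₀ ∈ multiExcited (m + 1)
      · exact hmulti _ hS
      rcases eq_zero_or_single_of_notMem_multiExcited hS with h | ⟨j, h⟩
      · rw [h, hvac]; rfl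
      · rw [h]; exact congrFun hu j
    · rw [← hgen]
      refine Finset.sum_congr rfl fun i _ => ?_
      have hK : ¬ ((Pi.single j 1 : QIdx (m + 1)) i.castSucc = 1 ∧
          (Pi.single j 1 : QIdx (m + 1)) i.succ = 1) := by
        rintro ⟨h1, h2⟩
        simp only [Pi.single_apply, ite_eq_left_iff, zero_ne_one, imp_false, not_not] at h1 h2
        exact (Fin.castSucc_lt_succ (i := i)).ne (h1.trans h2.symm)
      rw [if_neg hK, add_zero, hop_single]

/-- There are constants `c, k > 0` such that for all `n ≥ 2` every nonzero
eigenvalue of `H_{W,0}` on `(ℂ²)^{⊗n}` is at least `c·n^{-k}`: the spectral gap above the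
ground space closes at most polynomially fast in `n`. -/
theorem HW0_gap_poly :
    ∃ c k : ℝ, 0 < c ∧ 0 < k ∧
      ∀ n : ℕ, 2 ≤ n →
        ∀ μ : ℝ, (μ : ℂ) ∈ spectrum ℂ (HW0 n) → μ ≠ 0 →
          c * (n : ℝ) ^ (-k) ≤ μ := by
  refine ⟨1 / 4, 2, by norm_num, by norm_num, fun n hn μ hspec hμ => ?_⟩
  obtain ⟨m, rfl⟩ : ∃ m, n = m + 1 := ⟨n - 1, by omega⟩
  rw [← Matrix.spectrum_toLin', ← Module.End.hasEigenvalue_iff_mem_spectrum] at hspec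
  obtain ⟨ψ, hψ⟩ := hspec.exists_hasEigenvector
  have heig := hψ.apply_eq_smul
  rw [Matrix.toLin'_apply] at heig
  have h := one_le_eigenvalue_mul_sq hμ hψ.2 heig
  rw [Real.rpow_neg (by positivity), Real.rpow_two, ← div_eq_mul_inv,
    div_le_iff₀ (by positivity)]
  push_cast
  linarith

end QSim
end

section
/- Let n ≥ 2, let λ be the smallest nonzero eigenvalue of H_{W,0}, and let Γ satisfy Γλ > n, so that 0 is a simple eigenvalue of H_W with eigenvector |W_n⟩ and the restricted inverse G := (H_{W++})^{−1} is well defined. Then for all i ≠ j in {1,…,n}: Π₋ X_i G X_j Π₋ = (1/n)·(1 + Σ_{a≠i} Σ_{b≠j} ⟨e_a⊕e_i| G |e_b⊕e_j⟩)·Π₋, where X_k is the Pauli X operator on qubit k of the chain and |e_a⊕e_i⟩ denotes the computational basis state with 1s exactly in positions a and i. -/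
open Matrix
open scoped Kronecker ComplexOrder

namespace QSim

/-- The Pauli `Z` matrix. -/
noncomputable def Zmat : Matrix (Fin 2) (Fin 2) ℂ := !![1, 0; 0, -1]

/-- The Pauli `X` matrix. -/
noncomputable def Xmat : Matrix (Fin 2) (Fin 2) ℂ := !![0, 1; 1, 0]

/-- The W-state parent Hamiltonian `H_W = Γ·H_{W,0} + 1 - Σ_{i=1}^n (1 - Z_i)/2`. -/
noncomputable def HWham (n : ℕ) (Γ : ℝ) : QOp n :=
  (Γ : ℂ) • HW0 n + 1 - ∑ i : Fin n, oneQubitOp n i ((1 - Zmat) / 2)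

end QSim

namespace QSim

/-- The rank-one projector `Π₋ = |W_n⟩⟨W_n|` (entries are real, so no conjugation is needed). -/
noncomputable def projW (n : ℕ) : QOp n := fun x y => Wstate n x * Wstate n y

/-- The Pauli `X` operator on qubit `i` of the chain. -/
noncomputable def Xop (n : ℕ) (i : Fin n) : QOp n := oneQubitOp n i Xmat

/-- The computational basis index with `1`s exactly in positions `a` and `i` (for `a ≠ i`),
i.e. the label of the basis state `|e_a ⊕ e_i⟩`. -/
def pairIdx (n : ℕ) (a i : Fin n) : QIdx n := fun k => if k = a ∨ k = i then 1 else 0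

/-- The expectation value `⟨W_n| M |W_n⟩`. -/
noncomputable def expectW (n : ℕ) (M : QOp n) : ℂ :=
  star (Wstate n) ⬝ᵥ (M *ᵥ Wstate n)

end QSim

namespace QSim

/-- A matrix element of the number operator `(1 - Z) / 2` out of `|0⟩` vanishes. -/
lemma one_sub_Zmat_div_two_apply_zero (a : Fin 2) :
    ((1 - Zmat) / 2 : Matrix (Fin 2) (Fin 2) ℂ) a 0 = 0 := by
  have h2 : (2 : Matrix (Fin 2) (Fin 2) ℂ)⁻¹ = (2⁻¹ : ℂ) • 1 := by
    apply Matrix.inv_eq_right_inv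
    ext a b
    fin_cases a <;> fin_cases b <;> simp [Matrix.mul_apply, Matrix.ofNat_apply]
  rw [div_eq_mul_inv, h2, Matrix.mul_smul, mul_one]
  fin_cases a <;> simp [Zmat]

lemma HWham_apply_zero (n : ℕ) (Γ : ℝ) (x : QIdx n) :
    HWham n Γ x 0 = (1 : QOp n) x 0 := by
  have h0 : HW0 n x 0 = 0 := by
    simp [HW0, Matrix.sum_apply, twoQubitOp, Pentry, sgnE]
  have h1 : (∑ i : Fin n, oneQubitOp n i ((1 - Zmat) / 2)) x 0 = 0 := by
    simp only [Matrix.sum_apply, oneQubitOp, Pi.zero_apply, one_sub_Zmat_div_two_apply_zero,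
      zero_mul, Finset.sum_const_zero]
  simp [HWham, h0, h1]

/-- `H_W` fixes the all-zeros state. -/
lemma HWham_mulVec_single_zero (n : ℕ) (Γ : ℝ) :
    HWham n Γ *ᵥ Pi.single 0 1 = Pi.single 0 1 := by
  ext x
  rw [Matrix.mulVec_single_one, Matrix.col_apply, HWham_apply_zero, Matrix.one_apply,
    Pi.single_apply]

lemma Wstate_eq_sum (n : ℕ) :
    Wstate n = (((Real.sqrt n)⁻¹ : ℝ) : ℂ) •
      ∑ a : Fin n, (Pi.single (Pi.single a 1) 1 : QIdx n → ℂ) := by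
  ext x
  have hx : ∀ a : Fin n, (Finset.univ.filter fun k => x k = 1) = {a} ↔ x = Pi.single a 1 := by
    intro a
    simp only [Finset.ext_iff, funext_iff, Finset.mem_filter, Finset.mem_univ, true_and,
      Finset.mem_singleton, Pi.single_apply]
    refine forall_congr' fun k => ?_
    split_ifs with h <;> simp [h]
    omega
  simp only [Wstate, Pi.smul_apply, Finset.sum_apply, Pi.single_apply (M := ℂ),
    Finset.card_eq_one, hx, smul_eq_mul]
  split_ifs with h
  · obtain ⟨a, rfl⟩ := h
    have (c : Fin n) : (Pi.single a 1 : QIdx n) = Pi.single c 1 ↔ a = c := by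
      refine ⟨fun hc => ?_, fun hc => hc ▸ rfl⟩
      by_contra hne
      simpa [Pi.single_apply, hne] using congrFun hc a
    simp [this]
  · rw [Finset.sum_eq_zero fun a _ => if_neg fun ha => h ⟨a, ha⟩, mul_zero]

lemma Wstate_zero (n : ℕ) : Wstate n 0 = 0 := by simp [Wstate]

lemma projW_eq_vecMulVec (n : ℕ) : projW n = vecMulVec (Wstate n) (Wstate n) := rfl

lemma Xop_apply (n : ℕ) (i : Fin n) (x y : QIdx n) :
    Xop n i x y = if x = Function.update y i (1 - y i) then 1 else 0 := by
  have hX : ∀ a b : Fin 2, Xmat a b = if a = 1 - b then 1 else 0 := by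
    intro a b; fin_cases a <;> fin_cases b <;> simp [Xmat]
  simp only [Xop, oneQubitOp, hX, Function.eq_update_iff, mul_ite, mul_one, mul_zero]
  rw [← ite_and]
  refine if_congr ?_ rfl rfl
  rw [and_comm]

lemma Xop_transpose (n : ℕ) (i : Fin n) : (Xop n i)ᵀ = Xop n i := by
  have hX : ∀ a b : Fin 2, Xmat a b = Xmat b a := by
    intro a b; fin_cases a <;> fin_cases b <;> rfl
  ext x y
  simp only [transpose_apply, Xop, oneQubitOp, hX (y i), eq_comm (a := y _)]

/-- `X_j|W_n⟩` is, up to normalization, `|0…0⟩ + Σ_{b≠j} |e_b⊕e_j⟩`. -/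
lemma Xop_mulVec_Wstate (n : ℕ) (j : Fin n) :
    Xop n j *ᵥ Wstate n = (((Real.sqrt n)⁻¹ : ℝ) : ℂ) •
      (Pi.single 0 1 + ∑ b ∈ Finset.univ.erase j, Pi.single (pairIdx n b j) 1) := by
  have hX (y : QIdx n) : Xop n j *ᵥ Pi.single y 1 =
      Pi.single (Function.update y j (1 - y j)) 1 := by
    ext x
    rw [Matrix.mulVec_single_one, Matrix.col_apply, Xop_apply, Pi.single_apply]
  rw [Wstate_eq_sum, Matrix.mulVec_smul, Matrix.mulVec_sum,
    ← Finset.add_sum_erase _ _ (Finset.mem_univ j)]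
  simp only [hX]
  congr 2
  · congr 1
    ext k
    by_cases hk : k = j <;> simp [hk]
  · refine Finset.sum_congr rfl fun b hb => ?_
    have hbj : j ≠ b := (Finset.ne_of_mem_erase hb).symm
    congr 1
    ext k
    by_cases hk : k = j <;> simp [hk, pairIdx, hbj, Pi.single_apply]

lemma vecMulVec_mul_mul_vecMulVec {I : Type*} [Fintype I] (u v : I → ℂ) (M : Matrix I I ℂ) :
    vecMulVec u v * M * vecMulVec u v = (v ⬝ᵥ (M *ᵥ u)) • vecMulVec u v := by
  rw [mul_assoc, Matrix.mul_vecMulVec, Matrix.vecMulVec_mul_vecMulVec, Matrix.vecMulVec_smul]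

/-- Assume `λ` is the smallest nonzero eigenvalue of `H_{W,0}` and `Γλ > n`,
so that `0` is a simple eigenvalue of `H_W` with eigenvector `|W_n⟩` and the restricted
inverse `G = (H_{W++})^{-1}` is well defined (the unique Hermitian `G` with
`G·H_W = H_W·G = Π₊` and `G|W_n⟩ = 0`).  Then for all `i ≠ j`,
`Π₋ X_i G X_j Π₋ = (1/n)·(1 + Σ_{a≠i} Σ_{b≠j} ⟨e_a⊕e_i|G|e_b⊕e_j⟩)·Π₋`. -/
theorem projW_X_G_X_projW (n : ℕ) (hn : 2 ≤ n) (lam : ℝ) (hlam_pos : 0 < lam)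
    (hlam_mem : (lam : ℂ) ∈ spectrum ℂ (HW0 n))
    (hlam_min : ∀ μ : ℝ, (μ : ℂ) ∈ spectrum ℂ (HW0 n) → μ ≠ 0 → lam ≤ μ)
    (Γ : ℝ) (hΓ : (n : ℝ) < Γ * lam)
    (G : QOp n) (hG_herm : Gᴴ = G)
    (hG_left : G * HWham n Γ = 1 - projW n) (hG_right : HWham n Γ * G = 1 - projW n)
    (hG_W : G *ᵥ Wstate n = 0)
    (i j : Fin n) (hij : i ≠ j) :
    projW n * Xop n i * G * Xop n j * projW n
      = (((n : ℂ))⁻¹ *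
          (1 + ∑ a ∈ Finset.univ.erase i, ∑ b ∈ Finset.univ.erase j,
                G (pairIdx n a i) (pairIdx n b j))) • projW n := by
  have hcol : G *ᵥ Pi.single 0 1 = Pi.single 0 1 := by
    have h := congrArg (· *ᵥ (Pi.single 0 1 : QIdx n → ℂ)) hG_left
    simp only [← Matrix.mulVec_mulVec, HWham_mulVec_single_zero, Matrix.sub_mulVec,
      Matrix.one_mulVec] at h
    rw [h, sub_eq_self]
    ext x
    rw [Matrix.mulVec_single_one, Matrix.col_apply, projW, Wstate_zero, mul_zero, Pi.zero_apply]
  have hG0 (x : QIdx n) : G x 0 = if x = 0 then 1 else 0 := by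
    simpa [Pi.single_apply] using congrFun hcol x
  have hG0' (x : QIdx n) : G 0 x = if x = 0 then 1 else 0 := by
    rw [← hG_herm, conjTranspose_apply, hG0]
    split_ifs <;> simp
  have hpair (a k : Fin n) : pairIdx n a k ≠ 0 := fun h => by
    simpa [pairIdx] using congrFun h k
  have hs : (((Real.sqrt n)⁻¹ : ℝ) : ℂ) * (((Real.sqrt n)⁻¹ : ℝ) : ℂ) = (n : ℂ)⁻¹ := by
    rw [← Complex.ofReal_mul, ← mul_inv, Real.mul_self_sqrt n.cast_nonneg]
    simp
  rw [projW_eq_vecMulVec, mul_assoc _ (Xop n i), mul_assoc _ (Xop n i * G),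
    vecMulVec_mul_mul_vecMulVec]
  congr 1
  rw [← Matrix.mulVec_mulVec, ← Matrix.mulVec_mulVec, Matrix.dotProduct_mulVec,
    ← Matrix.mulVec_transpose, Xop_transpose, Xop_mulVec_Wstate, Xop_mulVec_Wstate,
    Matrix.mulVec_smul, smul_dotProduct, dotProduct_smul, smul_smul, hs, smul_eq_mul]
  congr 1
  simp [-Finset.sum_erase_eq_sub, Matrix.mulVec_add, Matrix.mulVec_sum, add_dotProduct, dotProduct_add, sum_dotProduct,
    dotProduct_sum, hG0, hG0', hpair]
  exact Finset.sum_comm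

end QSim
end
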